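/- For every integer n ≥ 3 and every finite generating set X of SL_n(ℤ), the normal Farb growth function of SL_n(ℤ) satisfies F_{SL_n(ℤ),X}(N) ≈ N^{n²−1}. (This is the main Corollary of the paper, instantiated at the Chevalley group SL_n, which has rank n−1 ≥ 2 and dimension n²−1.) -/

import Mathlib

open scoped Pointwise

section FarbDefs

variable {G : Type*} [Group G]

/-- Word length of `g` with respect to a generating set `X` (symmetrized). -/
noncomputable def wordLength (X : Set G) (g : G) : ℕ :=
  sInf {n | ∃ l : List G, l.length = n ∧ (∀ x ∈ l, x ∈ X ∨ x⁻¹ ∈ X) ∧ l.prod = g}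

/-- `farbD g` is the minimal cardinality of a finite quotient of `G` detecting `g`. -/
noncomputable def farbD (g : G) : ℕ :=
  sInf {k | ∃ N : Subgroup G, N.Normal ∧ N.FiniteIndex ∧ g ∉ N ∧ N.index = k}

/-- The normal Farb growth function of `G` with respect to `X`. -/
noncomputable def farbF (X : Set G) (n : ℕ) : ℕ :=
  sSup {d | ∃ g : G, g ≠ 1 ∧ wordLength X g ≤ n ∧ farbD g = d}

/-- The auxiliary function `F^k`. -/
noncomputable def farbFk (k : ℕ) (X : Set G) (n : ℕ) : ℕ :=
  sSup {d | ∃ g : G, g ^ k ≠ 1 ∧ wordLength X g ≤ n ∧ farbD (g ^ k) = d}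

/-- `f ≼ g` : there is `M` with `f n ≤ M * g (M * n)` for all `n`. -/
def FarbPreceq (f g : ℕ → ℕ) : Prop := ∃ M : ℕ, 0 < M ∧ ∀ n, f n ≤ M * g (M * n)

/-- `f ≈ g`. -/
def FarbEquiv (f g : ℕ → ℕ) : Prop := FarbPreceq f g ∧ FarbPreceq g f

/-- A group is residually finite if every nontrivial element is detected by a
finite quotient. -/
def ResiduallyFinite (G : Type*) [Group G] : Prop :=
  ∀ g : G, g ≠ 1 → ∃ N : Subgroup G, N.Normal ∧ N.FiniteIndex ∧ g ∉ N

end FarbDefs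

section WordLength

variable {G : Type*} [Group G] {X : Set G}

theorem wordLength_le_of_list {g : G} {l : List G} (hl : ∀ x ∈ l, x ∈ X ∨ x⁻¹ ∈ X)
    (hg : l.prod = g) : wordLength X g ≤ l.length :=
  Nat.sInf_le ⟨l, rfl, hl, hg⟩

theorem exists_list_length_eq_wordLength (hX : Subgroup.closure X = ⊤) (g : G) :
    ∃ l : List G, l.length = wordLength X g ∧ (∀ x ∈ l, x ∈ X ∨ x⁻¹ ∈ X) ∧ l.prod = g := by
  have hg' : g ∈ Submonoid.closure (X ∪ X⁻¹) := by
    rw [← Subgroup.closure_toSubmonoid, hX]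
    trivial
  obtain ⟨l, hl, hg⟩ := Submonoid.exists_list_of_mem_closure hg'
  exact Nat.sInf_mem
    (s := {n | ∃ l : List G, l.length = n ∧ (∀ x ∈ l, x ∈ X ∨ x⁻¹ ∈ X) ∧ l.prod = g})
    ⟨l.length, l, rfl, hl, hg⟩

theorem wordLength_one : wordLength X (1 : G) = 0 :=
  Nat.le_zero.1 (wordLength_le_of_list (l := []) (by simp) (by simp))

theorem eq_one_of_wordLength_eq_zero (hX : Subgroup.closure X = ⊤) {g : G}
    (hg : wordLength X g = 0) : g = 1 := by
  obtain ⟨l, hl, -, rfl⟩ := exists_list_length_eq_wordLength hX g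
  rw [hg, List.length_eq_zero_iff] at hl
  simp [hl]

theorem wordLength_mul_le (hX : Subgroup.closure X = ⊤) (g h : G) :
    wordLength X (g * h) ≤ wordLength X g + wordLength X h := by
  obtain ⟨l, hl, hlX, hlg⟩ := exists_list_length_eq_wordLength hX g
  obtain ⟨m, hm, hmX, hmh⟩ := exists_list_length_eq_wordLength hX h
  rw [← hl, ← hm, ← List.length_append]
  refine wordLength_le_of_list (fun x hx => ?_) (by simp [hlg, hmh])
  rcases List.mem_append.1 hx with hx | hx
  exacts [hlX x hx, hmX x hx]

theorem wordLength_inv_le (hX : Subgroup.closure X = ⊤) (g : G) :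
    wordLength X g⁻¹ ≤ wordLength X g := by
  obtain ⟨l, hl, hlX, hlg⟩ := exists_list_length_eq_wordLength hX g
  have h := wordLength_le_of_list (X := X) (g := g⁻¹) (l := (l.map (·⁻¹)).reverse)
    (fun x hx => ?_) (by rw [← hlg, List.prod_inv_reverse])
  · simpa [hl] using h
  · obtain ⟨y, hy, rfl⟩ := List.mem_map.1 (List.mem_reverse.1 hx)
    simpa [or_comm] using hlX y hy

theorem wordLength_pow_le (hX : Subgroup.closure X = ⊤) (g : G) (k : ℕ) :
    wordLength X (g ^ k) ≤ k * wordLength X g := by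
  induction k with
  | zero => simp [wordLength_one]
  | succ k ih =>
    have h := wordLength_mul_le hX (g ^ k) g
    rw [pow_succ, Nat.succ_mul]
    omega

end WordLength

namespace Matrix

variable {ι : Type*} [Fintype ι] [DecidableEq ι]

/-- Matrix entries grow at most exponentially in the word length. -/
theorem exists_abs_entry_le_pow_wordLength (X : Finset (SpecialLinearGroup ι ℤ))
    (hX : Subgroup.closure (X : Set (SpecialLinearGroup ι ℤ)) = ⊤) :
    ∃ C : ℕ, 2 ≤ C ∧ ∀ (g : SpecialLinearGroup ι ℤ) (i j : ι),
      |g i j| ≤ (C : ℤ) ^ wordLength (X : Set (SpecialLinearGroup ι ℤ)) g := by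
  classical
  set B : ℕ := ∑ x ∈ X ∪ X.image (·⁻¹), ∑ i, ∑ j, (x i j).natAbs with hB
  have hxB : ∀ x : SpecialLinearGroup ι ℤ, (x ∈ X ∨ x⁻¹ ∈ X) → ∀ i j, |x i j| ≤ (B : ℤ) := by
    intro x hx i j
    have hx' : x ∈ X ∪ X.image (·⁻¹) := by
      rcases hx with hx | hx
      · exact Finset.mem_union_left _ hx
      · exact Finset.mem_union_right _ (Finset.mem_image.2 ⟨_, hx, inv_inv x⟩)
    rw [Int.abs_eq_natAbs, Nat.cast_le]
    calc (x i j).natAbs ≤ ∑ j, (x i j).natAbs :=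
          Finset.single_le_sum (f := fun j => (x i j).natAbs) (fun _ _ => Nat.zero_le _)
            (Finset.mem_univ j)
      _ ≤ ∑ i, ∑ j, (x i j).natAbs :=
          Finset.single_le_sum (f := fun i => ∑ j, (x i j).natAbs) (fun _ _ => Nat.zero_le _)
            (Finset.mem_univ i)
      _ ≤ B := Finset.single_le_sum (f := fun x : SpecialLinearGroup ι ℤ =>
            ∑ i, ∑ j, (x i j).natAbs) (fun _ _ => Nat.zero_le _) hx'
  refine ⟨Fintype.card ι * B + 2, by omega, fun g => ?_⟩
  obtain ⟨l, hl, hlX, rfl⟩ := exists_list_length_eq_wordLength hX g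
  rw [← hl]
  clear hl
  induction l with
  | nil =>
    intro i j
    rcases eq_or_ne i j with rfl | hij
    · simp
    · simp [hij]
  | cons x l ih =>
    intro i j
    have ih' := ih fun y hy => hlX y (List.mem_cons_of_mem _ hy)
    have hx := hxB x (hlX x List.mem_cons_self)
    rw [List.prod_cons, SpecialLinearGroup.coe_mul, Matrix.mul_apply, List.length_cons, pow_succ']
    calc |∑ k, x i k * l.prod k j|
        ≤ ∑ k, |x i k * l.prod k j| := Finset.abs_sum_le_sum_abs _ _
      _ ≤ ∑ _k : ι, (B : ℤ) * ((Fintype.card ι * B + 2 : ℕ) : ℤ) ^ l.length := by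
          refine Finset.sum_le_sum fun k _ => ?_
          rw [abs_mul]
          exact mul_le_mul (hx i k) (ih' k j) (abs_nonneg _) (by positivity)
      _ = (Fintype.card ι * B : ℤ) * ((Fintype.card ι * B + 2 : ℕ) : ℤ) ^ l.length := by
          simp [mul_assoc]
      _ ≤ _ := by
          gcongr
          push_cast
          omega

end Matrix

/-- A linear form of Chebyshev's lower bound for the product of the primes up to `K * N`. -/
theorem exists_forall_mul_lt_theta (b : ℝ) :
    ∃ K : ℕ, 0 < K ∧ ∀ N : ℕ, 0 < N → b * N < Chebyshev.theta ((K * N : ℕ) : ℝ) := by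
  have hlog := (isLittleO_log_rpow_atTop (r := 1 / 2) (by norm_num)).bound
    (c := 1 / 40) (by norm_num)
  have hlog' := (isLittleO_log_rpow_atTop (r := 1) (by norm_num)).bound
    (c := 1 / 40) (by norm_num)
  obtain ⟨x₀, hx₀⟩ := Filter.eventually_atTop.1 (hlog.and hlog')
  have key : ∀ m : ℕ, 10 ≤ m → x₀ ≤ m → (m : ℝ) / 2 ≤ Chebyshev.theta m := by
    intro m hm hmx
    have h1 : (10 : ℝ) ≤ m := by exact_mod_cast hm
    obtain ⟨hl, hl'⟩ := hx₀ m hmx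
    have hpos : 0 ≤ Real.log m := Real.log_nonneg (by linarith)
    rw [Real.norm_of_nonneg hpos, Real.norm_of_nonneg (by positivity), ← Real.sqrt_eq_rpow] at hl
    rw [Real.norm_of_nonneg hpos, Real.norm_of_nonneg (by positivity), Real.rpow_one] at hl'
    have hl1 : Real.log (m + 1) ≤ Real.log m + 1 / m := by
      have h := Real.log_le_sub_one_of_pos (x := (m + 1) / m) (by positivity)
      rw [Real.log_div (by positivity) (by positivity)] at h
      have h2 : ((m : ℝ) + 1) / m - 1 = 1 / m := by field_simp; ring
      linarith
    have hm' : 1 / (m : ℝ) ≤ 1 / 10 := one_div_le_one_div_of_le (by norm_num) h1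
    have h2 := Real.log_two_gt_d9
    have hs : Real.sqrt m * Real.log m ≤ 1 / 40 * m := by
      calc Real.sqrt m * Real.log m ≤ Real.sqrt m * (1 / 40 * Real.sqrt m) := by gcongr
        _ = 1 / 40 * (Real.sqrt m * Real.sqrt m) := by ring
        _ = 1 / 40 * m := by rw [Real.mul_self_sqrt (by positivity)]
    have h3 := Chebyshev.theta_ge m
    have h4 : (m : ℝ) * 0.69 ≤ m * Real.log 2 := by
      gcongr
      linarith
    linarith
  refine ⟨⌈x₀⌉₊ + ⌈2 * b⌉₊ + 10, by omega, fun N hN => ?_⟩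
  have hN1 : (1 : ℝ) ≤ N := by exact_mod_cast hN
  set K : ℕ := ⌈x₀⌉₊ + ⌈2 * b⌉₊ + 10 with hK
  have hKx : x₀ + 2 * b + 10 ≤ (K : ℝ) ∧ x₀ ≤ K ∧ 2 * b + 10 ≤ K := by
    have h1 := Nat.le_ceil x₀
    have h2 := Nat.le_ceil (2 * b)
    have h3 : (0 : ℝ) ≤ ⌈x₀⌉₊ := Nat.cast_nonneg _
    have h4 : (0 : ℝ) ≤ ⌈2 * b⌉₊ := Nat.cast_nonneg _
    rw [hK]
    push_cast
    refine ⟨?_, ?_, ?_⟩ <;> linarith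
  have hKN : (K : ℝ) ≤ ((K * N : ℕ) : ℝ) := by
    exact_mod_cast Nat.le_mul_of_pos_right K hN
  refine lt_of_lt_of_le ?_ (key (K * N) ?_ (by linarith))
  · push_cast
    nlinarith
  · exact le_trans (by omega) (Nat.le_mul_of_pos_right K hN)

/-- An integer of size at most `2 * C ^ N` is prime to some prime that is linear in `N`. -/
theorem exists_prime_le_mul_not_dvd (C : ℕ) (hC : 2 ≤ C) :
    ∃ K : ℕ, 0 < K ∧ ∀ N : ℕ, 0 < N → ∀ a : ℤ, a ≠ 0 → |a| ≤ 2 * (C : ℤ) ^ N →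
      ∃ p : ℕ, p.Prime ∧ p ≤ K * N ∧ ¬ (p : ℤ) ∣ a := by
  obtain ⟨K, hK0, hK⟩ := exists_forall_mul_lt_theta (2 * Real.log C)
  refine ⟨K, hK0, fun N hN a ha hab => ?_⟩
  by_contra! hcon
  have hdvd : primorial (K * N) ∣ a.natAbs := by
    rw [primorial_eq_prod_primesLE]
    refine Finset.prod_primes_dvd _ (fun p hp => (Nat.prime_of_mem_primesLE hp).prime)
      fun p hp => ?_
    exact Int.natCast_dvd.1 (hcon p (Nat.prime_of_mem_primesLE hp) (Nat.le_of_mem_primesLE hp))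
  have hle : primorial (K * N) ≤ C ^ (2 * N) := by
    refine (Nat.le_of_dvd (Int.natAbs_pos.2 ha) hdvd).trans ?_
    have h1 : a.natAbs ≤ 2 * C ^ N := by
      rw [Int.abs_eq_natAbs] at hab
      exact_mod_cast hab
    calc a.natAbs ≤ 2 * C ^ N := h1
      _ ≤ C ^ N * C ^ N := by
          gcongr
          exact hC.trans (Nat.le_self_pow hN.ne' C)
      _ = C ^ (2 * N) := by ring
  have hlt := hK N hN
  rw [Chebyshev.theta_eq_log_primorial, Nat.floor_natCast] at hlt
  have h2 : Real.log (primorial (K * N)) ≤ Real.log ((C : ℝ) ^ (2 * N)) :=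
    Real.log_le_log (by exact_mod_cast primorial_pos _) (by exact_mod_cast hle)
  rw [Real.log_pow] at h2
  push_cast at h2
  linarith

namespace Matrix

section Card

variable {F : Type*} [Field F]

theorem card_SL_mul_card_units [Finite F] (n : ℕ) [NeZero n] :
    Nat.card (SpecialLinearGroup (Fin n) F) * Nat.card Fˣ = Nat.card (GL (Fin n) F) := by
  classical
  have hker : Nat.card (GeneralLinearGroup.det : GL (Fin n) F →* Fˣ).ker =
      Nat.card (SpecialLinearGroup (Fin n) F) := by
    refine (Nat.card_congr (Equiv.ofBijective
      (fun A : SpecialLinearGroup (Fin n) F =>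
        (⟨(A : GL (Fin n) F), ?_⟩ : (GeneralLinearGroup.det : GL (Fin n) F →* Fˣ).ker)) ⟨?_, ?_⟩)).symm
    · rw [MonoidHom.mem_ker]
      ext
      simp
    · intro A B h
      apply Subtype.ext
      have h' := congrArg (fun M : (GeneralLinearGroup.det : GL (Fin n) F →* Fˣ).ker =>
        ((M : GL (Fin n) F) : Matrix (Fin n) (Fin n) F)) h
      simpa using h'
    · rintro ⟨A, hA⟩
      refine ⟨⟨A, ?_⟩, ?_⟩
      · have := congrArg Units.val (MonoidHom.mem_ker.1 hA)
        simpa using this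
      · apply Subtype.ext
        ext
        rfl
  have hsurj : Function.Surjective (GeneralLinearGroup.det : GL (Fin n) F →* Fˣ) := by
    intro u
    refine ⟨GeneralLinearGroup.mkOfDetNeZero
      (diagonal fun i => if i = 0 then (u : F) else 1) ?_, ?_⟩
    · simp [det_diagonal, Finset.prod_ite_eq']
    · ext
      simp [GeneralLinearGroup.mkOfDetNeZero, det_diagonal]
  rw [← hker, ← Subgroup.card_mul_index (GeneralLinearGroup.det : GL (Fin n) F →* Fˣ).ker,
    Subgroup.index_ker, MonoidHom.range_eq_top.2 hsurj, Subgroup.card_top]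

theorem card_center_SL_le (n : ℕ) [NeZero n] :
    Nat.card (Subgroup.center (SpecialLinearGroup (Fin n) F)) ≤ n := by
  rw [Nat.card_congr (SpecialLinearGroup.center_equiv_rootsOfUnity' (R := F) (0 : Fin n)).toEquiv,
    Fintype.card_fin]
  exact card_rootsOfUnity F n

variable [Fintype F]

theorem card_SL_le (n : ℕ) [NeZero n] :
    Nat.card (SpecialLinearGroup (Fin n) F) ≤ 2 * Fintype.card F ^ (n ^ 2 - 1) := by
  classical
  have h := card_SL_mul_card_units (F := F) n
  have hn : 1 ≤ n ^ 2 := Nat.one_le_pow _ _ (Nat.pos_of_neZero n)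
  have hGL : Nat.card (GL (Fin n) F) ≤ Fintype.card F ^ n ^ 2 := by
    calc Nat.card (GL (Fin n) F) ≤ Nat.card (Matrix (Fin n) (Fin n) F) :=
          Nat.card_le_card_of_injective _ Units.val_injective
      _ = Fintype.card F ^ n ^ 2 := by
          rw [Nat.card_eq_fintype_card]
          rw [show Fintype.card (Matrix (Fin n) (Fin n) F) = Fintype.card (Fin n → Fin n → F) from
            rfl]
          simp [← pow_mul, sq]
  rw [Nat.card_eq_fintype_card (α := Fˣ), Fintype.card_units] at h
  have hq : 2 ≤ Fintype.card F := Fintype.one_lt_card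
  have hq' : Fintype.card F ≤ 2 * (Fintype.card F - 1) := by omega
  refine Nat.le_of_mul_le_mul_right (c := Fintype.card F - 1) ?_ (by omega)
  calc _ ≤ Fintype.card F ^ n ^ 2 := h.trans_le hGL
    _ = Fintype.card F ^ (n ^ 2 - 1) * Fintype.card F := by
        rw [← pow_succ, Nat.sub_add_cancel hn]
    _ ≤ Fintype.card F ^ (n ^ 2 - 1) * (2 * (Fintype.card F - 1)) := by gcongr
    _ = _ := by ring

theorem pow_le_card_SL (n : ℕ) [NeZero n] :
    Fintype.card F ^ (n ^ 2 - 1) ≤ 2 ^ n * Nat.card (SpecialLinearGroup (Fin n) F) := by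
  classical
  have h := card_SL_mul_card_units (F := F) n
  have hn : 1 ≤ n ^ 2 := Nat.one_le_pow _ _ (Nat.pos_of_neZero n)
  have hq : 2 ≤ Fintype.card F := Fintype.one_lt_card
  have hGL : Fintype.card F ^ n ^ 2 ≤ 2 ^ n * Nat.card (GL (Fin n) F) := by
    rw [card_GL_field]
    calc Fintype.card F ^ n ^ 2 = ∏ _i : Fin n, Fintype.card F ^ n := by
          simp [← pow_mul, sq]
      _ ≤ ∏ i : Fin n, 2 * (Fintype.card F ^ n - Fintype.card F ^ (i : ℕ)) := by
          refine Finset.prod_le_prod' fun i _ => ?_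
          have h1 : Fintype.card F ^ ((i : ℕ) + 1) ≤ Fintype.card F ^ n :=
            Nat.pow_le_pow_right (by omega) i.2
          have h2 : Fintype.card F ^ (i : ℕ) * 2 ≤ Fintype.card F ^ ((i : ℕ) + 1) := by
            rw [pow_succ]
            gcongr
          omega
      _ = _ := by simp [Finset.prod_mul_distrib]
  rw [Nat.card_eq_fintype_card (α := Fˣ), Fintype.card_units] at h
  refine Nat.le_of_mul_le_mul_right (c := Fintype.card F) ?_ (by omega)
  calc Fintype.card F ^ (n ^ 2 - 1) * Fintype.card F = Fintype.card F ^ n ^ 2 := by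
        rw [← pow_succ, Nat.sub_add_cancel hn]
    _ ≤ 2 ^ n * (Nat.card (SpecialLinearGroup (Fin n) F) * (Fintype.card F - 1)) := by
        rw [h]
        exact hGL
    _ ≤ 2 ^ n * (Nat.card (SpecialLinearGroup (Fin n) F) * Fintype.card F) := by
        gcongr
        omega
    _ = _ := by ring

/-- The order of the simple group `PSL_n(F)` is comparable to `|F| ^ (n ^ 2 - 1)`. -/
theorem pow_le_index_center_SL (n : ℕ) [NeZero n] :
    Fintype.card F ^ (n ^ 2 - 1) ≤
      2 ^ n * n * (Subgroup.center (SpecialLinearGroup (Fin n) F)).index := by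
  refine (pow_le_card_SL n).trans ?_
  rw [← Subgroup.card_mul_index (Subgroup.center (SpecialLinearGroup (Fin n) F)), mul_assoc]
  gcongr
  exact card_center_SL_le n

end Card

section Surjectivity

variable {ι F : Type*} [Fintype ι] [DecidableEq ι] [Field F]

theorem SpecialLinearGroup.diag2n_eq_prod_transvection {i j : ι} (hij : i ≠ j) {c : F}
    (hc : c ≠ 0) :
    SpecialLinearGroup.diag2n hij c hc =
      transvection hij c * transvection hij.symm (-c⁻¹) * transvection hij c *
        (transvection hij (-1) * transvection hij.symm 1 * transvection hij (-1)) := by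
  apply Subtype.ext
  ext k l
  simp only [coe_mul, transvection_coe, diag2n_coe, mul_add, add_mul, mul_one, one_mul,
    single_mul_single_same, single_mul_single_of_ne _ _ _ _ hij,
    single_mul_single_of_ne _ _ _ _ hij.symm, add_zero]
  simp only [Matrix.add_apply, Matrix.one_apply, Matrix.single_apply, Matrix.diagonal_apply]
  by_cases hki : k = i
  · subst hki
    by_cases hlk : l = k
    · subst hlk
      simp [hij.symm, mul_inv_cancel₀ hc]
    · by_cases hlj : l = j
      · subst hlj
        simp [hij, hij.symm, hc]
      · simp [Ne.symm hlk, Ne.symm hlj]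
  · by_cases hkj : k = j
    · subst hkj
      by_cases hlk : l = k
      · subst hlk
        simp [hij, hij.symm, hc]
      · by_cases hli : l = i
        · subst hli
          simp [hij, hij.symm, hc]
        · simp [Ne.symm hlk, Ne.symm hli, hij]
    · simp [hki, hkj, Ne.symm hki, Ne.symm hkj]

theorem SpecialLinearGroup.map_transvection {R S : Type*} [CommRing R] [CommRing S] (f : R →+* S)
    {i j : ι} (hij : i ≠ j) (c : R) :
    SpecialLinearGroup.map f (transvection hij c) = transvection hij (f c) := by
  apply Subtype.ext
  ext k l
  simp [transvection_coe, Matrix.one_apply, Matrix.single_apply, apply_ite f]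

theorem SpecialLinearGroup.map_surjective_of_field [Nontrivial ι] {R : Type*} [CommRing R]
    (f : R →+* F) (hf : Function.Surjective f) :
    Function.Surjective (SpecialLinearGroup.map (n := ι) f) := by
  have htrans : ∀ (i j : ι) (hij : i ≠ j) (a : F),
      transvection hij a ∈ (SpecialLinearGroup.map (n := ι) f).range := by
    intro i j hij a
    obtain ⟨r, rfl⟩ := hf a
    exact ⟨_, SpecialLinearGroup.map_transvection f hij r⟩
  intro M
  change M ∈ (SpecialLinearGroup.map (n := ι) f).range
  refine SpecialLinearGroup.diagonal_transvection_induction'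
    (fun M => M ∈ (SpecialLinearGroup.map (n := ι) f).range) M (fun i j hij c hc => ?_) htrans
    (fun A B => Subgroup.mul_mem _)
  rw [SpecialLinearGroup.diag2n_eq_prod_transvection]
  refine mul_mem (mul_mem (mul_mem ?_ ?_) ?_) (mul_mem (mul_mem ?_ ?_) ?_) <;> apply htrans

end Surjectivity

end Matrix

theorem Subgroup.Normal.mul_conj_inv_mem {G : Type*} [Group G] {N : Subgroup G}
    (hN : N.Normal) {g : G} (hg : g ∈ N) (h : G) : g * (h * g⁻¹ * h⁻¹) ∈ N :=
  N.mul_mem hg (hN.conj_mem _ (N.inv_mem hg) h)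

namespace Matrix

section NormalSubgroups

open _root_.Matrix.SpecialLinearGroup (transvection)

variable {ι R : Type*} [Fintype ι] [DecidableEq ι] [CommRing R]

theorem exists_ne_ne_of_two_lt_card (hι : 2 < Fintype.card ι) (a b : ι) : ∃ c, c ≠ a ∧ c ≠ b := by
  obtain ⟨c, -, hc⟩ := Finset.exists_mem_notMem_of_card_lt_card
    (s := {a, b}) (t := Finset.univ) (Finset.card_le_two.trans_lt hι)
  exact ⟨c, by grind⟩

theorem SpecialLinearGroup.transvection_mul_apply {i j : ι} (hij : i ≠ j) (c : R)
    (M : Matrix ι ι R) (a b : ι) :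
    ((transvection hij c).1 * M) a b = M a b + if a = i then c * M j b else 0 := by
  change (Matrix.transvection i j c * M) a b = _
  split_ifs with h
  · subst h
    simp
  · simp [h]

theorem SpecialLinearGroup.mul_transvection_apply {i j : ι} (hij : i ≠ j) (c : R)
    (M : Matrix ι ι R) (a b : ι) :
    (M * (transvection hij c).1) a b = M a b + if b = j then c * M a i else 0 := by
  change (M * Matrix.transvection i j c) a b = _
  split_ifs with h
  · subst h
    simp
  · simp [h]

theorem SpecialLinearGroup.transvection_apply {i j : ι} (hij : i ≠ j) (c : R) (a b : ι) :
    (transvection hij c).1 a b = (if a = b then 1 else 0) + if a = i ∧ b = j then c else 0 := by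
  simp only [SpecialLinearGroup.transvection_coe, Matrix.add_apply, Matrix.one_apply,
    Matrix.single_apply]
  grind

theorem SpecialLinearGroup.transvection_mul_transvection {i j k : ι} (hij : i ≠ j) (hjk : j ≠ k)
    (hik : i ≠ k) (c d : R) :
    transvection hij c * transvection hjk d =
      transvection hik (c * d) * (transvection hjk d * transvection hij c) := by
  apply Subtype.ext
  ext a b
  simp only [SpecialLinearGroup.coe_mul, SpecialLinearGroup.transvection_mul_apply,
    SpecialLinearGroup.transvection_apply]
  grind

variable {N : Subgroup (SpecialLinearGroup ι R)}

/-- Elementary matrices in a normal subgroup can be moved to any other off-diagonal position. -/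
theorem SpecialLinearGroup.transvection_mem_of_transvection_mem (hN : N.Normal)
    (hι : 2 < Fintype.card ι) {i j k l : ι} (hij : i ≠ j) (hkl : k ≠ l) {c : R}
    (hc : transvection hij c ∈ N) : transvection hkl c ∈ N := by
  have hcol : ∀ {i j k : ι} (hij : i ≠ j) (hik : i ≠ k), transvection hij c ∈ N →
      transvection hik c ∈ N := by
    intro i j k hij hik h
    by_cases hjk : j = k
    · subst hjk
      exact h
    · have := Subgroup.Normal.mul_conj_inv_mem hN h (transvection hjk 1)
      rw [← mul_assoc, ← mul_assoc, SpecialLinearGroup.transvection_mul_transvection hij hjk hik,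
        mul_one] at this
      simpa [mul_assoc] using this
  have hrow : ∀ {i j k : ι} (hij : i ≠ j) (hkj : k ≠ j), transvection hij c ∈ N →
      transvection hkj c ∈ N := by
    intro i j k hij hkj h
    by_cases hki : k = i
    · subst hki
      exact h
    · have := hN.conj_mem _ h (transvection hki 1)
      rw [SpecialLinearGroup.transvection_mul_transvection hki hij hkj, one_mul, mul_assoc,
        mul_assoc, mul_inv_cancel, mul_one] at this
      simpa using N.mul_mem this (N.inv_mem h)
  by_cases hli : l = i
  · subst hli
    obtain ⟨m, hm1, hm2⟩ := exists_ne_ne_of_two_lt_card hι l j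
    exact hrow hm1 hkl (hcol hm2 hm1 (hrow hij hm2 hc))
  · exact hrow (Ne.symm hli) hkl (hcol hij (Ne.symm hli) hc)

variable {p : R}

theorem SpecialLinearGroup.dvd_of_eq_one_add_mem (hN : N.Normal) (hι : 2 < Fintype.card ι)
    (hp : ∀ (i j : ι) (hij : i ≠ j) (c : R), transvection hij c ∈ N → p ∣ c)
    {D : SpecialLinearGroup ι R} (hD : D ∈ N) {r : ι} {u : ι → R}
    (hDu : ∀ a b, D.1 a b = (if a = b then 1 else 0) + if b = r then u a else 0) (hur : u r = 0)
    {k : ι} (hk : k ≠ r) : p ∣ u k := by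
  obtain ⟨i, hik, hir⟩ := exists_ne_ne_of_two_lt_card hι k r
  refine hp i r hir (u k) ?_
  have hmul : transvection hik 1 * D = transvection hir (u k) * (D * transvection hik 1) := by
    apply Subtype.ext
    ext a b
    simp only [SpecialLinearGroup.coe_mul, SpecialLinearGroup.transvection_mul_apply,
      SpecialLinearGroup.mul_transvection_apply, hDu]
    grind
  have h := hN.conj_mem _ hD (transvection hik 1)
  rw [hmul, mul_assoc, mul_assoc, mul_inv_cancel, mul_one] at h
  simpa using N.mul_mem h (N.inv_mem hD)

theorem SpecialLinearGroup.dvd_sub_one_of_row_eq (hN : N.Normal) (hι : 2 < Fintype.card ι)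
    (hp : ∀ (i j : ι) (hij : i ≠ j) (c : R), transvection hij c ∈ N → p ∣ c)
    {B : SpecialLinearGroup ι R} (hB : B ∈ N) {r : ι}
    (hBr : ∀ b, B.1 r b = if r = b then 1 else 0) {j k : ι} (hj : j ≠ r) (hk : k ≠ r) :
    p ∣ B.1 k j - if k = j then 1 else 0 := by
  set E := transvection hj (1 : R) with hE
  have hD := Subgroup.Normal.mul_conj_inv_mem hN hB E
  refine SpecialLinearGroup.dvd_of_eq_one_add_mem hN hι hp hD (r := r)
    (u := fun a => B.1 a j - if a = j then 1 else 0) ?_ ?_ hk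
  · set D' : Matrix ι ι R := fun a b => (if a = b then 1 else 0) +
      if b = r then (B.1 a j - if a = j then 1 else 0) else 0 with hD'
    have hD'1 : D' = 1 + vecMulVec (fun a => B.1 a j - if a = j then 1 else 0)
        (Pi.single r 1) := by
      ext a b
      simp [hD', Matrix.one_apply, vecMulVec_apply, Pi.single_apply]
    have hmul : D' * (E * B).1 = (B * E).1 := by
      rw [hD'1, add_mul, one_mul, vecMulVec_mul]
      ext a b
      simp only [Matrix.add_apply, vecMulVec_apply, Matrix.single_one_vecMul, hE,
        SpecialLinearGroup.coe_mul, SpecialLinearGroup.transvection_mul_apply,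
        SpecialLinearGroup.mul_transvection_apply, Matrix.row_apply, hBr]
      grind
    have hDD : (B * (E * B⁻¹ * E⁻¹)).1 = D' := by
      have : B * (E * B⁻¹ * E⁻¹) = B * E * (E * B)⁻¹ := by group
      rw [this, SpecialLinearGroup.coe_mul, ← hmul, mul_assoc, ← SpecialLinearGroup.coe_mul,
        mul_inv_cancel, SpecialLinearGroup.coe_one, mul_one]
    intro a b
    rw [hDD]
  · simp [hBr, hj.symm]

theorem SpecialLinearGroup.dvd_apply_of_mem (hN : N.Normal) (hι : 2 < Fintype.card ι)
    (hpp : Prime p) (hp : ∀ (i j : ι) (hij : i ≠ j) (c : R), transvection hij c ∈ N → p ∣ c)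
    {A : SpecialLinearGroup ι R} (hA : A ∈ N) {r i : ι} (hir : i ≠ r) : p ∣ A.1 r i := by
  obtain ⟨k, hkr, hki⟩ := exists_ne_ne_of_two_lt_card hι r i
  set v : ι → R := fun a => (if a = i then A.1 r k else 0) - if a = k then A.1 r i else 0 with hv
  set T := transvection hir (A.1 r k) * transvection hkr (-A.1 r i) with hT
  set x : ι → R := A.1 *ᵥ v with hx
  set y : ι → R := (A⁻¹).1 r with hy
  have hvr : v r = 0 := by simp [hv, hir.symm, hkr.symm]
  have hxr : x r = 0 := by
    simp only [hx, hv, mulVec, dotProduct, mul_sub, Finset.sum_sub_distrib, mul_ite, mul_zero,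
      Finset.sum_ite_eq', Finset.mem_univ, if_true]
    ring
  have hTv : T.1 = 1 + vecMulVec v (Pi.single r 1) := by
    ext a b
    simp only [hT, hv, SpecialLinearGroup.coe_mul, SpecialLinearGroup.transvection_mul_apply,
      SpecialLinearGroup.transvection_apply, Matrix.add_apply, Matrix.one_apply, vecMulVec_apply,
      Pi.single_apply]
    grind
  have hAA : A.1 * (A⁻¹).1 = 1 := by
    rw [← SpecialLinearGroup.coe_mul, mul_inv_cancel, SpecialLinearGroup.coe_one]
  have hAA' : (A⁻¹).1 * A.1 = 1 := by
    rw [← SpecialLinearGroup.coe_mul, inv_mul_cancel, SpecialLinearGroup.coe_one]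
  set B := A * (T * A⁻¹ * T⁻¹) with hB
  have hBT : B.1 * T.1 = 1 + vecMulVec x y := by
    have hBT : B * T = A * T * A⁻¹ := by
      rw [hB]
      group
    rw [← SpecialLinearGroup.coe_mul, hBT, SpecialLinearGroup.coe_mul,
      SpecialLinearGroup.coe_mul, hTv, mul_add, mul_one, add_mul, hAA,
      mul_vecMulVec, vecMulVec_mul, Matrix.single_one_vecMul]
    rfl
  have hBT' : ∀ a b, B.1 a b + (if b = r then (B.1 *ᵥ v) a else 0) =
      (if a = b then 1 else 0) + x a * y b := by
    intro a b
    have := congrFun (congrFun hBT a) b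
    rw [hTv, mul_add, mul_one, mul_vecMulVec] at this
    simpa [Matrix.one_apply, vecMulVec_apply, Pi.single_apply] using this
  have hBne : ∀ a b, b ≠ r → B.1 a b = (if a = b then 1 else 0) + x a * y b := by
    intro a b hb
    simpa [hb] using hBT' a b
  have hBv : (B.1 *ᵥ v) r = 0 := by
    rw [mulVec, dotProduct]
    refine Finset.sum_eq_zero fun b _ => ?_
    by_cases hb : b = r
    · rw [hb, hvr, mul_zero]
    · rw [hBne r b hb, hxr, if_neg (Ne.symm hb)]
      ring
  have hBr : ∀ b, B.1 r b = if r = b then 1 else 0 := by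
    intro b
    simpa [hBv, hxr] using hBT' r b
  have hxy : ∀ a j, j ≠ r → p ∣ x a * y j := by
    intro a j hj
    by_cases ha : a = r
    · rw [ha, hxr, zero_mul]
      exact dvd_zero p
    · have := SpecialLinearGroup.dvd_sub_one_of_row_eq hN hι hp
        (Subgroup.Normal.mul_conj_inv_mem hN hA T) hBr hj ha
      rwa [← hB, hBne a j hj, add_sub_cancel_left] at this
  by_cases hyj : ∀ j, j ≠ r → p ∣ y j
  · have hyA : ∀ b, ∑ a, y a * A.1 a b = if r = b then 1 else 0 := by
      intro b
      have := congrFun (congrFun hAA' r) b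
      rwa [Matrix.mul_apply, Matrix.one_apply] at this
    have hyb : ∀ b, p ∣ (if r = b then 1 else 0) - y r * A.1 r b := by
      intro b
      rw [← hyA b, ← Finset.add_sum_erase _ _ (Finset.mem_univ r), add_sub_cancel_left]
      exact Finset.dvd_sum fun a ha => (hyj a (Finset.ne_of_mem_erase ha)).mul_right _
    have hi := hyb i
    rw [if_neg hir.symm, zero_sub, dvd_neg] at hi
    refine (hpp.dvd_or_dvd hi).resolve_left fun h => hpp.not_dvd_one ?_
    have hr := hyb r
    rw [if_pos rfl] at hr
    exact (dvd_sub_left (h.mul_right _)).1 hr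
  · push Not at hyj
    obtain ⟨j, hj, hpj⟩ := hyj
    have hxa : ∀ a, p ∣ x a := fun a => (hpp.dvd_or_dvd (hxy a j hj)).resolve_right hpj
    have hvx : (A⁻¹).1 *ᵥ x = v := by
      rw [hx, mulVec_mulVec, hAA', one_mulVec]
    have hvk : p ∣ v k := by
      rw [← hvx]
      exact Finset.dvd_sum fun a _ => (hxa a).mul_left _
    simpa [hv, hki] using hvk

/-- A normal subgroup all of whose elementary matrices are trivial modulo a prime `p` is central
modulo `p`. -/
theorem SpecialLinearGroup.map_mem_center_of_mem (hN : N.Normal) (hι : 2 < Fintype.card ι)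
    (hpp : Prime p) (hp : ∀ (i j : ι) (hij : i ≠ j) (c : R), transvection hij c ∈ N → p ∣ c)
    {S : Type*} [CommRing S] {f : R →+* S} (hf : f p = 0)
    {A : SpecialLinearGroup ι R} (hA : A ∈ N) :
    SpecialLinearGroup.map f A ∈ Subgroup.center (SpecialLinearGroup ι S) := by
  have hf' : ∀ {c}, p ∣ c → f c = 0 := by
    rintro _ ⟨d, rfl⟩
    rw [map_mul, hf, zero_mul]
  have hoff : ∀ i j, i ≠ j → f (A.1 i j) = 0 := fun i j hij =>
    hf' (SpecialLinearGroup.dvd_apply_of_mem hN hι hpp hp hA hij.symm)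
  have hdiag : ∀ i j, f (A.1 i i) = f (A.1 j j) := by
    intro i j
    by_cases hij : i = j
    · rw [hij]
    · set E := transvection hij (1 : R)
      have hE := hN.conj_mem _ hA E
      set B := E * A * E⁻¹ with hB
      have hBE : (B * E).1 = (E * A).1 := by rw [hB, inv_mul_cancel_right]
      have h1 := congrFun (congrFun hBE i) j
      have h2 := congrFun (congrFun hBE i) i
      simp only [SpecialLinearGroup.coe_mul, E, SpecialLinearGroup.transvection_mul_apply,
        SpecialLinearGroup.mul_transvection_apply, if_true, hij, if_false, one_mul,
        add_zero] at h1 h2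
      have h3 := hf' (SpecialLinearGroup.dvd_apply_of_mem hN hι hpp hp hE (Ne.symm hij))
      have h4 := congrArg f h1
      rw [h2] at h4
      simp only [map_add, h3, hoff i j hij, hoff j i (Ne.symm hij)] at h4
      simpa using h4
  obtain ⟨i⟩ : Nonempty ι := Fintype.card_pos_iff.1 (by omega)
  have hs : scalar ι (f (A.1 i i)) = (SpecialLinearGroup.map f A).1 := by
    ext a b
    rw [scalar_apply, diagonal_apply]
    split_ifs with h
    · subst h
      exact hdiag _ _
    · exact (hoff a b h).symm
  refine SpecialLinearGroup.mem_center_iff.2 ⟨f (A.1 i i), ?_, hs⟩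
  rw [← (SpecialLinearGroup.map f A).2, ← hs, scalar_apply, det_diagonal, Finset.prod_const,
    Finset.card_univ]

end NormalSubgroups

end Matrix

namespace Matrix

section LogarithmicWordLength

open _root_.Matrix.SpecialLinearGroup (transvection)

variable {ι : Type*} [Fintype ι] [DecidableEq ι]

theorem two_pow_le_fib (k : ℕ) : 2 ^ k ≤ Nat.fib (2 * k + 1) := by
  induction k with
  | zero => simp
  | succ k ih =>
    have h1 : Nat.fib (2 * (k + 1) + 1) = Nat.fib (2 * k + 1) + Nat.fib (2 * k + 2) :=
      Nat.fib_add_two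
    have h2 : Nat.fib (2 * k + 1) ≤ Nat.fib (2 * k + 2) := Nat.fib_mono (Nat.le_succ _)
    rw [pow_succ]
    omega

theorem fib_le_three_mul_fib (k : ℕ) :
    Nat.fib (2 * (k + 1) + 1) ≤ 3 * Nat.fib (2 * k + 1) := by
  have h1 : Nat.fib (2 * (k + 1) + 1) = Nat.fib (2 * k + 1) + Nat.fib (2 * k + 2) :=
    Nat.fib_add_two
  have h2 : Nat.fib (2 * k + 2) = Nat.fib (2 * k) + Nat.fib (2 * k + 1) := Nat.fib_add_two
  have h3 : Nat.fib (2 * k) ≤ Nat.fib (2 * k + 1) := Nat.fib_mono (Nat.le_succ _)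
  omega

variable {R : Type*} [CommRing R] {i j r : ι} (hij : i ≠ j) (hir : i ≠ r) (hjr : j ≠ r)

theorem SpecialLinearGroup.hyperbolic_mul_unipotent (a b : R) :
    transvection hij (1 : R) * transvection hij.symm 1 *
        (transvection hir a * transvection hjr b) =
      transvection hir (2 * a + b) * transvection hjr (a + b) *
        (transvection hij 1 * transvection hij.symm 1) := by
  apply Subtype.ext
  ext x y
  simp only [SpecialLinearGroup.coe_mul, mul_assoc, SpecialLinearGroup.transvection_mul_apply,
    SpecialLinearGroup.transvection_apply]
  grind

theorem SpecialLinearGroup.hyperbolic_pow_mul_transvection (k : ℕ) (c : R) :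
    (transvection hij (1 : R) * transvection hij.symm 1) ^ k * transvection hir c =
      transvection hir (c * Nat.fib (2 * k + 1)) * transvection hjr (c * Nat.fib (2 * k)) *
        (transvection hij 1 * transvection hij.symm 1) ^ k := by
  induction k with
  | zero => simp
  | succ k ih =>
    have h1 : Nat.fib (2 * (k + 1) + 1) = Nat.fib (2 * k + 1) + Nat.fib (2 * k + 2) :=
      Nat.fib_add_two
    have h2 : Nat.fib (2 * (k + 1)) = Nat.fib (2 * k) + Nat.fib (2 * k + 1) := Nat.fib_add_two
    have h3 : Nat.fib (2 * k + 2) = Nat.fib (2 * k) + Nat.fib (2 * k + 1) := Nat.fib_add_two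
    rw [pow_succ', mul_assoc, ih, ← mul_assoc,
      SpecialLinearGroup.hyperbolic_mul_unipotent hij hir hjr, mul_assoc]
    congr 3
    · rw [h1, h3]
      push_cast
      ring
    · rw [h2]
      push_cast
      ring

theorem SpecialLinearGroup.unipotent_mul_unipotent (a b c d : R) :
    transvection hir a * transvection hjr b * (transvection hir c * transvection hjr d) =
      transvection hir (a + c) * transvection hjr (b + d) := by
  apply Subtype.ext
  ext x y
  simp only [SpecialLinearGroup.coe_mul, mul_assoc, SpecialLinearGroup.transvection_mul_apply,
    SpecialLinearGroup.transvection_apply]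
  grind

theorem SpecialLinearGroup.transvection_one_mul_unipotent (a b : R) :
    transvection hij.symm (1 : R) * (transvection hir a * transvection hjr b) =
      transvection hjr a * (transvection hir a * transvection hjr b) *
        transvection hij.symm (1 : R) := by
  apply Subtype.ext
  ext x y
  simp only [SpecialLinearGroup.coe_mul, mul_assoc, SpecialLinearGroup.transvection_mul_apply,
    SpecialLinearGroup.transvection_apply]
  grind

theorem SpecialLinearGroup.transvection_one_pow (a : ℕ) :
    transvection hij (1 : R) ^ a = transvection hij (a : R) := by
  induction a with
  | zero => simp
  | succ a ih =>
    rw [pow_succ, ih]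
    apply Subtype.ext
    ext x y
    simp only [SpecialLinearGroup.coe_mul, SpecialLinearGroup.transvection_mul_apply,
      SpecialLinearGroup.transvection_apply]
    grind

/-- Elementary matrices have logarithmic word length in `SL_n(ℤ)` for `n ≥ 3`. -/
theorem SpecialLinearGroup.exists_wordLength_transvection_le
    {i j r : ι} (hij : i ≠ j) (hir : i ≠ r) (hjr : j ≠ r)
    {X : Set (SpecialLinearGroup ι ℤ)} (hX : Subgroup.closure X = ⊤) :
    ∃ C : ℕ, ∀ k a : ℕ, a < 2 ^ k →
      wordLength X (transvection hjr (a : ℤ)) ≤ C * (k + 1) := by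
  set A : SpecialLinearGroup ι ℤ := transvection hij 1 * transvection hij.symm 1 with hA
  set C := 3 * wordLength X (transvection hir (1 : ℤ)) + wordLength X A with hC
  have key : ∀ k a : ℕ, a < Nat.fib (2 * k + 1) → ∃ b : ℤ,
      wordLength X (transvection hir (a : ℤ) * transvection hjr b * A ^ k) ≤ C * k := by
    intro k
    induction k with
    | zero =>
      intro a ha
      obtain rfl : a = 0 := by simpa using ha
      exact ⟨0, by simp [wordLength_one]⟩
    | succ k ih =>
      intro a ha
      have hf : 0 < Nat.fib (2 * k + 1) := Nat.fib_pos.2 (by omega)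
      obtain ⟨b, hb⟩ := ih _ (Nat.mod_lt a hf)
      set c := a / Nat.fib (2 * k + 1) with hc
      have hc3 : c ≤ 3 := by
        have h3 := fib_le_three_mul_fib k
        exact (Nat.div_lt_of_lt_mul (by rw [mul_comm]; exact ha.trans_le h3)).le
      have hac : (a : ℤ) = (a % Nat.fib (2 * k + 1) : ℕ) + (c : ℤ) * Nat.fib (2 * k + 1) := by
        rw [hc]
        exact_mod_cast (Nat.mod_add_div' _ _).symm
      refine ⟨b + c * Nat.fib (2 * k), ?_⟩
      have hprod : transvection hir (a : ℤ) * transvection hjr (b + c * Nat.fib (2 * k)) *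
          A ^ (k + 1) =
          transvection hir ((a % Nat.fib (2 * k + 1) : ℕ) : ℤ) * transvection hjr b * A ^ k *
            (transvection hir (1 : ℤ) ^ c * A) := by
        have hpow := SpecialLinearGroup.hyperbolic_pow_mul_transvection hij hir hjr k (c : ℤ)
        rw [← hA] at hpow
        clear_value A
        rw [SpecialLinearGroup.transvection_one_pow, ← mul_assoc, mul_assoc _ (A ^ k),
          hpow, ← mul_assoc, SpecialLinearGroup.unipotent_mul_unipotent, ← hac,
          mul_assoc _ (A ^ k), ← pow_succ]
      rw [hprod]
      have h1 := wordLength_mul_le hX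
        (transvection hir ((a % Nat.fib (2 * k + 1) : ℕ) : ℤ) * transvection hjr b * A ^ k)
        (transvection hir (1 : ℤ) ^ c * A)
      have h2 := wordLength_mul_le hX (transvection hir (1 : ℤ) ^ c) A
      have h3 := wordLength_pow_le hX (transvection hir (1 : ℤ)) c
      have h4 := Nat.mul_le_mul_right (wordLength X (transvection hir (1 : ℤ))) hc3
      rw [mul_add, mul_one]
      omega
  set w := wordLength X A
  set e := wordLength X (transvection hij.symm (1 : ℤ)) with he
  refine ⟨2 * (C + w) + 2 * e, fun k a ha => ?_⟩
  obtain ⟨b, hb⟩ := key k a (ha.trans_le (two_pow_le_fib k))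
  set τ := transvection hir (a : ℤ) * transvection hjr b with hτ
  have hτw : wordLength X τ ≤ (C + w) * k := by
    have h1 := wordLength_mul_le hX (τ * A ^ k) (A ^ k)⁻¹
    rw [mul_inv_cancel_right] at h1
    have h2 := wordLength_inv_le hX (A ^ k)
    have h3 := wordLength_pow_le hX A k
    rw [add_mul, mul_comm w]
    rw [mul_comm] at h3
    grind
  have hcomm : transvection hjr (a : ℤ) =
      transvection hij.symm 1 * τ * ((transvection hij.symm 1)⁻¹ * τ⁻¹) := by
    rw [hτ, SpecialLinearGroup.transvection_one_mul_unipotent hij hir hjr, ← hτ]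
    group
  rw [hcomm]
  have h1 := wordLength_mul_le hX (transvection hij.symm 1 * τ)
    ((transvection hij.symm 1)⁻¹ * τ⁻¹)
  have h2 := wordLength_mul_le hX (transvection hij.symm 1) τ
  have h3 := wordLength_mul_le hX (transvection hij.symm 1)⁻¹ τ⁻¹
  have h4 := wordLength_inv_le hX τ
  have h5 := wordLength_inv_le hX (transvection hij.symm (1 : ℤ))
  nlinarith

end LogarithmicWordLength

end Matrix

section Quotients

variable {G : Type*} [Group G]

theorem farbD_le_index {g : G} (N : Subgroup G) [N.Normal] [N.FiniteIndex] (hg : g ∉ N) :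
    farbD g ≤ N.index :=
  Nat.sInf_le ⟨N, inferInstance, inferInstance, hg, rfl⟩

theorem exists_index_eq_farbD (hG : ResiduallyFinite G) {g : G} (hg : g ≠ 1) :
    ∃ N : Subgroup G, N.Normal ∧ N.FiniteIndex ∧ g ∉ N ∧ N.index = farbD g := by
  obtain ⟨N, hN, hN', hgN⟩ := hG g hg
  exact Nat.sInf_mem
    (s := {k | ∃ N : Subgroup G, N.Normal ∧ N.FiniteIndex ∧ g ∉ N ∧ N.index = k})
    ⟨_, N, hN, hN', hgN, rfl⟩

end Quotients

namespace Matrix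

section UpperBound

theorem SpecialLinearGroup.exists_apply_sub_one_ne_zero {ι R : Type*} [Fintype ι] [DecidableEq ι]
    [CommRing R] {g : SpecialLinearGroup ι R} (hg : g ≠ 1) :
    ∃ i j, g i j - (1 : Matrix ι ι R) i j ≠ 0 := by
  by_contra! h
  exact hg (SpecialLinearGroup.ext _ _ fun i j => by simpa using sub_eq_zero.1 (h i j))

theorem SpecialLinearGroup.notMem_ker_map {n p : ℕ} {g : SpecialLinearGroup (Fin n) ℤ}
    {i j : Fin n} (h : ¬ (p : ℤ) ∣ g i j - (1 : Matrix (Fin n) (Fin n) ℤ) i j) :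
    g ∉ (SpecialLinearGroup.map (n := Fin n) (Int.castRingHom (ZMod p))).ker := by
  intro hg
  apply h
  rw [MonoidHom.mem_ker] at hg
  have h1 := congrFun (congrFun (congrArg Subtype.val hg) i) j
  rw [← ZMod.intCast_zmod_eq_zero_iff_dvd]
  push_cast
  rw [sub_eq_zero]
  refine Eq.trans h1 ?_
  rw [SpecialLinearGroup.coe_one, Matrix.one_apply, Matrix.one_apply]
  split_ifs <;> simp

theorem SpecialLinearGroup.index_ker_map_le (n p : ℕ) [NeZero n] [Fact p.Prime] :
    (SpecialLinearGroup.map (n := Fin n) (Int.castRingHom (ZMod p))).ker.index ≤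
      2 * p ^ (n ^ 2 - 1) := by
  rw [Subgroup.index_ker]
  refine (Subgroup.card_le_card_group _).trans ?_
  simpa [ZMod.card] using card_SL_le (F := ZMod p) n

theorem SpecialLinearGroup.exists_farbD_le (n : ℕ) [NeZero n]
    (X : Finset (SpecialLinearGroup (Fin n) ℤ))
    (hX : Subgroup.closure (X : Set (SpecialLinearGroup (Fin n) ℤ)) = ⊤) :
    ∃ K : ℕ, 0 < K ∧ ∀ (N : ℕ) (g : SpecialLinearGroup (Fin n) ℤ), g ≠ 1 →
      wordLength (X : Set (SpecialLinearGroup (Fin n) ℤ)) g ≤ N →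
      farbD g ≤ 2 * (K * N) ^ (n ^ 2 - 1) := by
  obtain ⟨C, hC, hCX⟩ := exists_abs_entry_le_pow_wordLength X hX
  obtain ⟨K, hK, hKC⟩ := exists_prime_le_mul_not_dvd C hC
  refine ⟨K, hK, fun N g hg hgN => ?_⟩
  have hN : 0 < N := by
    by_contra! h
    exact hg (eq_one_of_wordLength_eq_zero hX (by omega))
  obtain ⟨i, j, hij⟩ := SpecialLinearGroup.exists_apply_sub_one_ne_zero hg
  have hbound : |g i j - (1 : Matrix (Fin n) (Fin n) ℤ) i j| ≤ 2 * (C : ℤ) ^ N := by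
    have hC1 : (1 : ℤ) ≤ C := by omega
    have h1 : |g i j| ≤ (C : ℤ) ^ N := (hCX g i j).trans (pow_le_pow_right₀ hC1 hgN)
    have h2 : |(1 : Matrix (Fin n) (Fin n) ℤ) i j| ≤ 1 := by
      rw [Matrix.one_apply]
      split_ifs <;> simp
    have h3 : (1 : ℤ) ≤ (C : ℤ) ^ N := one_le_pow₀ hC1
    have h4 := abs_sub (g i j) ((1 : Matrix (Fin n) (Fin n) ℤ) i j)
    linarith
  obtain ⟨p, hp, hpN, hpd⟩ := hKC N hN _ hij hbound
  have : Fact p.Prime := ⟨hp⟩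
  calc farbD g ≤ _ := farbD_le_index _ (SpecialLinearGroup.notMem_ker_map hpd)
    _ ≤ 2 * p ^ (n ^ 2 - 1) := SpecialLinearGroup.index_ker_map_le n p
    _ ≤ _ := by gcongr

theorem SpecialLinearGroup.residuallyFinite_int (n : ℕ) :
    ResiduallyFinite (SpecialLinearGroup (Fin n) ℤ) := by
  intro g hg
  obtain ⟨i, j, hij⟩ := SpecialLinearGroup.exists_apply_sub_one_ne_zero hg
  obtain ⟨p, hp, hpp⟩ := Nat.exists_infinite_primes
    ((g i j - (1 : Matrix (Fin n) (Fin n) ℤ) i j).natAbs + 1)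
  have : Fact p.Prime := ⟨hpp⟩
  refine ⟨_, inferInstance, inferInstance, SpecialLinearGroup.notMem_ker_map (p := p)
    (i := i) (j := j) fun h => ?_⟩
  have := Nat.le_of_dvd (Int.natAbs_pos.2 hij) (Int.natCast_dvd.1 h)
  omega

end UpperBound

section LowerBound

open _root_.Matrix.SpecialLinearGroup (transvection)

theorem SpecialLinearGroup.transvection_one_zpow {ι R : Type*} [Fintype ι] [DecidableEq ι]
    [CommRing R] {i j : ι} (hij : i ≠ j) (a : ℤ) :
    transvection hij (1 : R) ^ a = transvection hij (a : R) := by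
  obtain ⟨k, rfl | rfl⟩ := a.eq_nat_or_neg
  · rw [zpow_natCast, SpecialLinearGroup.transvection_one_pow, Int.cast_natCast]
  · rw [_root_.zpow_neg, zpow_natCast, SpecialLinearGroup.transvection_one_pow, Int.cast_neg,
      Int.cast_natCast]
    refine inv_eq_of_mul_eq_one_right ?_
    apply Subtype.ext
    ext x y
    simp only [SpecialLinearGroup.coe_mul, SpecialLinearGroup.transvection_mul_apply,
      SpecialLinearGroup.transvection_apply, SpecialLinearGroup.coe_one, Matrix.one_apply]
    grind

theorem lcmUpto_le_two_pow (N : ℕ) : Nat.lcmUpto N ≤ 2 ^ (8 * N) := by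
  have hpos : (0 : ℝ) < Nat.lcmUpto N := by exact_mod_cast Nat.lcmUpto_pos N
  have h1 := Chebyshev.psi_le_const_mul_self (x := N) (Nat.cast_nonneg N)
  rw [Chebyshev.psi_eq_log_lcmUpto] at h1
  have h2 : Real.log 4 = 2 * Real.log 2 := by
    rw [show (4 : ℝ) = 2 ^ 2 by norm_num, Real.log_pow]
    norm_num
  have h3 := Real.log_two_gt_d9
  have h4 : Real.log (Nat.lcmUpto N) ≤ Real.log ((2 : ℝ) ^ (8 * N)) := by
    rw [Real.log_pow]
    push_cast
    nlinarith [Nat.cast_nonneg (α := ℝ) N]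
  exact_mod_cast (Real.log_le_log_iff hpos (by positivity)).1 h4

/-- If `m < N ^ d` does not divide a large power of `lcm(1, …, N)`, then it has a large prime
factor. -/
theorem exists_prime_gt_dvd {N d m : ℕ} (hm : m ≠ 0) (hmN : m < N ^ d)
    (hmd : ¬ m ∣ Nat.lcmUpto N ^ (2 * d)) : ∃ p, p.Prime ∧ N < p ∧ p ∣ m := by
  by_contra! h
  apply hmd
  rw [← Nat.factorization_le_iff_dvd hm (pow_ne_zero _ (Nat.lcmUpto_pos N).ne')]
  intro p
  by_cases hp : p.Prime
  swap
  · simp [Nat.factorization_eq_zero_of_not_prime _ hp]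
  by_cases hpm : p ∣ m
  swap
  · simp [Nat.factorization_eq_zero_of_not_dvd hpm]
  have hpN : p ≤ N := by
    by_contra! hlt
    exact h p hp hlt hpm
  rw [Nat.factorization_pow, Finsupp.smul_apply, smul_eq_mul, Nat.factorization_lcmUpto N hp]
  by_contra! hlt
  have hlog : 1 ≤ Nat.log p N := Nat.log_pos hp.one_lt hpN
  have hN : N ≤ p ^ (2 * Nat.log p N) :=
    (Nat.lt_pow_succ_log_self hp.one_lt N).le.trans
      (Nat.pow_le_pow_right hp.pos (by omega))
  have : N ^ d ≤ m := calc
    N ^ d ≤ (p ^ (2 * Nat.log p N)) ^ d := Nat.pow_le_pow_left hN d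
    _ = p ^ (2 * d * Nat.log p N) := by rw [← pow_mul]; ring_nf
    _ ≤ p ^ m.factorization p := Nat.pow_le_pow_right hp.pos hlt.le
    _ ≤ m := Nat.le_of_dvd (Nat.pos_of_ne_zero hm) (Nat.ordProj_dvd m p)
  omega

theorem SpecialLinearGroup.pow_le_index_of_prime {n p : ℕ} (hn : 3 ≤ n) (hp : p.Prime)
    {H : Subgroup (SpecialLinearGroup (Fin n) ℤ)} (hH : H.Normal) [H.FiniteIndex]
    (hHp : ∀ (i j : Fin n) (hij : i ≠ j) (c : ℤ), transvection hij c ∈ H → (p : ℤ) ∣ c) :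
    p ^ (n ^ 2 - 1) ≤ 2 ^ n * n * H.index := by
  have : Fact p.Prime := ⟨hp⟩
  have : NeZero n := ⟨by omega⟩
  have : Nontrivial (Fin n) := Fin.nontrivial_iff_two_le.2 (by omega)
  set f := SpecialLinearGroup.map (n := Fin n) (Int.castRingHom (ZMod p))
  have hf : Function.Surjective f :=
    SpecialLinearGroup.map_surjective_of_field _ (ZMod.ringHom_surjective _)
  have hle : H ≤ (Subgroup.center (SpecialLinearGroup (Fin n) (ZMod p))).comap f := fun A hA =>
    SpecialLinearGroup.map_mem_center_of_mem hH (by rwa [Fintype.card_fin])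
      (Nat.prime_iff_prime_int.1 hp) hHp (by simp) hA
  have hindex : (Subgroup.center (SpecialLinearGroup (Fin n) (ZMod p))).index ≤ H.index := by
    rw [← Subgroup.index_comap_of_surjective _ hf]
    exact Nat.le_of_dvd (Nat.pos_of_ne_zero Subgroup.FiniteIndex.index_ne_zero)
      (Subgroup.index_dvd_of_le hle)
  have := pow_le_index_center_SL (F := ZMod p) n
  rw [ZMod.card] at this
  exact this.trans (Nat.mul_le_mul_left _ hindex)

theorem SpecialLinearGroup.pow_le_index_of_notMem {n N : ℕ} (hn : 3 ≤ n)
    {H : Subgroup (SpecialLinearGroup (Fin n) ℤ)} (hH : H.Normal) [H.FiniteIndex]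
    {i j : Fin n} (hij : i ≠ j)
    (hg : transvection hij ((Nat.lcmUpto N ^ (2 * (n ^ 2 - 1)) : ℕ) : ℤ) ∉ H) :
    N ^ (n ^ 2 - 1) ≤ 2 ^ n * n * H.index := by
  set m := orderOf (transvection hij (1 : ℤ) : SpecialLinearGroup (Fin n) ℤ ⧸ H) with hm
  have hmem : ∀ t : ℤ, transvection hij t ∈ H ↔ (m : ℤ) ∣ t := by
    intro t
    rw [hm, orderOf_dvd_iff_zpow_eq_one, ← QuotientGroup.mk_zpow, QuotientGroup.eq_one_iff,
      SpecialLinearGroup.transvection_one_zpow, Int.cast_id]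
  have hm0 : m ≠ 0 := (orderOf_pos _).ne'
  by_cases hmN : N ^ (n ^ 2 - 1) ≤ m
  · have h1 : m ≤ H.index := by
      rw [Subgroup.index]
      exact orderOf_le_card
    have h2 : 0 < 2 ^ n * n := by positivity
    exact (hmN.trans h1).trans (Nat.le_mul_of_pos_left _ h2)
  · rw [hmem, Int.natCast_dvd_natCast] at hg
    obtain ⟨p, hp, hNp, hpm⟩ := exists_prime_gt_dvd hm0 (not_le.1 hmN) hg
    refine (Nat.pow_le_pow_left hNp.le _).trans
      (SpecialLinearGroup.pow_le_index_of_prime hn hp hH fun k l hkl c hc => ?_)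
    have := SpecialLinearGroup.transvection_mem_of_transvection_mem hH (by rwa [Fintype.card_fin])
      hkl hij hc
    exact (Int.natCast_dvd_natCast.2 hpm).trans ((hmem c).1 this)

end LowerBound

end Matrix

/-- For `n ≥ 3` and every finite generating set `X` of `SL_n(ℤ)`,
the normal Farb growth function satisfies `F_{SL_n(ℤ),X}(N) ≈ N ^ (n² - 1)`. -/
theorem farb_growth_SL_int (n : ℕ) (hn : 3 ≤ n)
    (X : Finset (Matrix.SpecialLinearGroup (Fin n) ℤ))
    (hX : Subgroup.closure (X : Set (Matrix.SpecialLinearGroup (Fin n) ℤ)) = ⊤) :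
    FarbEquiv (farbF (X : Set (Matrix.SpecialLinearGroup (Fin n) ℤ)))
      (fun N => N ^ (n ^ 2 - 1)) := by
  have : NeZero n := ⟨by omega⟩
  set d := n ^ 2 - 1 with hd
  have hd0 : 0 < d := by
    have : 3 ^ 2 ≤ n ^ 2 := Nat.pow_le_pow_left hn 2
    omega
  obtain ⟨K, hK, hKX⟩ := Matrix.SpecialLinearGroup.exists_farbD_le n X hX
  refine ⟨⟨2 * K ^ d, by positivity, fun N => ?_⟩, ?_⟩
  · refine csSup_le' ?_
    rintro _ ⟨g, hg1, hgN, rfl⟩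
    refine (hKX N g hg1 hgN).trans ?_
    rw [mul_pow, ← mul_assoc]
    exact Nat.mul_le_mul_left _
      (Nat.pow_le_pow_left (Nat.le_mul_of_pos_left N (by positivity)) d)
  · have hij : (⟨0, by omega⟩ : Fin n) ≠ ⟨1, by omega⟩ := by simp
    have hri : (⟨2, by omega⟩ : Fin n) ≠ ⟨0, by omega⟩ := by simp
    have hrj : (⟨2, by omega⟩ : Fin n) ≠ ⟨1, by omega⟩ := by simp
    obtain ⟨C, hC⟩ := Matrix.SpecialLinearGroup.exists_wordLength_transvection_le
      hri hrj hij hX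
    set M := C * (16 * d + 2) + 2 ^ n * n with hM
    refine ⟨M, by positivity, fun N => ?_⟩
    rcases Nat.eq_zero_or_pos N with rfl | hN
    · simp [hd0.ne']
    set L := Nat.lcmUpto N ^ (2 * d) with hL
    set g := Matrix.SpecialLinearGroup.transvection hij (L : ℤ) with hg
    have hL0 : L ≠ 0 := pow_ne_zero _ (Nat.lcmUpto_pos N).ne'
    have hg1 : g ≠ 1 := by
      intro h
      have := congrFun (congrFun (congrArg Subtype.val h) ⟨0, by omega⟩) ⟨1, by omega⟩
      rw [Matrix.SpecialLinearGroup.transvection_apply] at this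
      simp [hL0] at this
    have hwl : wordLength (X : Set (Matrix.SpecialLinearGroup (Fin n) ℤ)) g ≤ M * N := by
      refine (hC (16 * d * N + 1) L ?_).trans ?_
      · calc L ≤ (2 ^ (8 * N)) ^ (2 * d) := Nat.pow_le_pow_left (Matrix.lcmUpto_le_two_pow N) _
          _ = 2 ^ (16 * d * N) := by rw [← pow_mul]; ring_nf
          _ < _ := Nat.pow_lt_pow_right one_lt_two (Nat.lt_succ_self _)
      · calc C * (16 * d * N + 1 + 1) ≤ C * ((16 * d + 2) * N) := by gcongr; linarith
          _ ≤ M * N := by rw [hM]; nlinarith [Nat.zero_le (2 ^ n * n * N)]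
    obtain ⟨H, hH, hH', hgH, hHg⟩ :=
      exists_index_eq_farbD (Matrix.SpecialLinearGroup.residuallyFinite_int n) hg1
    have hle : farbD g ≤ farbF (X : Set (Matrix.SpecialLinearGroup (Fin n) ℤ)) (M * N) := by
      refine le_csSup ⟨2 * (K * (M * N)) ^ d, ?_⟩ ⟨g, hg1, hwl, rfl⟩
      rintro _ ⟨h, hh1, hhN, rfl⟩
      exact hKX _ h hh1 hhN
    calc N ^ d ≤ 2 ^ n * n * H.index :=
        Matrix.SpecialLinearGroup.pow_le_index_of_notMem hn hH hij hgH
      _ ≤ M * farbF (X : Set (Matrix.SpecialLinearGroup (Fin n) ℤ)) (M * N) := by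
        rw [hHg]
        exact Nat.mul_le_mul (Nat.le_add_left _ _) hle
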